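/- Fix a real N>0 and 0<δ<1. Define the rotation r_x(w)=e^{ix/N}·w for x∈ℝ, the rotated slit map Ŝ_x := f_N⁻¹∘r_x⁻¹∘g⁻¹∘φ^δ∘g∘r_x∘f_N, and the cylinder shift η_y := f_N⁻¹∘r_y∘f_N. Then for every n≥1, all reals y, x₁,…,x_n, and every z∈ℍ (for which all compositions are defined): f_N( η_{−y}( Ŝ_{x₁}∘Ŝ_{x₂}∘⋯∘Ŝ_{x_n}( η_y(z) ) ) ) = f_N( Ŝ_{x₁+y}∘Ŝ_{x₂+y}∘⋯∘Ŝ_{x_n+y}(z) ); that is, as self-maps of the cylinder (i.e. after applying f_N, which identifies points differing by 2πN), conjugating an n-fold composition of slit maps by the cylinder shift η_y shifts all attachment points by y. (Key identity in the proof that CHL^N is ergodic with respect to cylinder shifts.) -/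

import Mathlib

open Complex Filter

/-- The map `f_N(z) = exp(-iz/N)` from the cylinder to the complement of the unit disk. -/
noncomputable def fN (N : ℝ) (z : ℂ) : ℂ := Complex.exp (-Complex.I * z / N)

/-- The inverse map `f_N⁻¹(w) = iN·Log w` (principal branch). -/
noncomputable def fNinv (N : ℝ) (w : ℂ) : ℂ := Complex.I * N * Complex.log w

/-- The Möbius map `g(z) = i(z-1)/(z+1)`. -/
noncomputable def gMap (z : ℂ) : ℂ := Complex.I * (z - 1) / (z + 1)

/-- The inverse Möbius map `g⁻¹(w) = (i+w)/(i-w)`. -/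
noncomputable def gInv (w : ℂ) : ℂ := (Complex.I + w) / (Complex.I - w)

/-- The half-plane slit map `φ^δ(z) = z·(1-δ²-δ²/z²)^{1/2}` (principal square root). -/
noncomputable def phiSlit (δ : ℝ) (z : ℂ) : ℂ :=
  z * (1 - (δ:ℂ)^2 - (δ:ℂ)^2 / z^2) ^ ((1:ℂ)/2)

/-- The cylindrical slit map `S^{N,δ} = f_N⁻¹∘g⁻¹∘φ^δ∘g∘f_N`. -/
noncomputable def cylSlit (N δ : ℝ) (z : ℂ) : ℂ :=
  fNinv N (gInv (phiSlit δ (gMap (fN N z))))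

/-- The slit-size parameter `δ(N,λ) = 1 - 2/(1+e^{λ/N})`. -/
noncomputable def deltaN (N lam : ℝ) : ℝ := 1 - 2 / (1 + Real.exp (lam / N))


/-- The rotation `r_x(w) = e^{ix/N} w`. -/
noncomputable def rotN (N x : ℝ) (w : ℂ) : ℂ := Complex.exp (Complex.I * x / N) * w

/-- The slit map attaching a slit above the point `x` of the cylinder:
`Ŝ_x = f_N⁻¹ ∘ r_x⁻¹ ∘ g⁻¹ ∘ φ^δ ∘ g ∘ r_x ∘ f_N`. -/
noncomputable def slitAt (N δ x : ℝ) (z : ℂ) : ℂ :=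
  fNinv N (rotN N (-x) (gInv (phiSlit δ (gMap (rotN N x (fN N z))))))

/-- The cylinder shift `η_y = f_N⁻¹ ∘ r_y ∘ f_N`. -/
noncomputable def etaShift (N y : ℝ) (z : ℂ) : ℂ := fNinv N (rotN N y (fN N z))

lemma fN_fNinv {N : ℝ} (hN : 0 < N) {w : ℂ} (hw : w ≠ 0) : fN N (fNinv N w) = w := by
  have hN' : (N : ℂ) ≠ 0 := by exact_mod_cast hN.ne'
  have h : -Complex.I * (Complex.I * N * Complex.log w) / N = Complex.log w := by
    field_simp
    linear_combination (-Complex.log w) * Complex.I_sq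
  rw [fN, fNinv, h, Complex.exp_log hw]

lemma one_lt_norm_fN {N : ℝ} (hN : 0 < N) {z : ℂ} (hz : 0 < z.im) : 1 < ‖fN N z‖ := by
  have h : (-Complex.I * z / N).re = z.im / N := by
    rw [Complex.div_ofReal_re]
    simp
  rw [fN, Complex.norm_exp, h, Real.one_lt_exp_iff]
  positivity

lemma norm_rotN (N x : ℝ) (w : ℂ) : ‖rotN N x w‖ = ‖w‖ := by
  have h : (Complex.I * x / N).re = 0 := by
    rw [Complex.div_ofReal_re]
    simp
  rw [rotN, norm_mul, Complex.norm_exp, h, Real.exp_zero, one_mul]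

lemma rotN_rotN (N x y : ℝ) (w : ℂ) : rotN N x (rotN N y w) = rotN N (x + y) w := by
  simp only [rotN]
  rw [← mul_assoc, ← Complex.exp_add]
  push_cast
  ring_nf

lemma rotN_zero (N : ℝ) (w : ℂ) : rotN N 0 w = w := by
  simp [rotN]

lemma add_one_ne_zero_of_one_lt_norm {w : ℂ} (hw : 1 < ‖w‖) : w + 1 ≠ 0 := by
  intro h
  rw [eq_neg_of_add_eq_zero_left h] at hw
  simp at hw

lemma gMap_im_pos {w : ℂ} (hw : 1 < ‖w‖) : 0 < (gMap w).im := by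
  have h1 := add_one_ne_zero_of_one_lt_norm hw
  have h2 : 0 < Complex.normSq (w + 1) := Complex.normSq_pos.mpr h1
  have h3 : 1 < w.re * w.re + w.im * w.im := by
    rw [← Complex.normSq_apply, Complex.normSq_eq_norm_sq]
    nlinarith
  have h4 : (gMap w).im = (w.re * w.re + w.im * w.im - 1) / Complex.normSq (w + 1) := by
    simp [gMap, Complex.div_im]
    field_simp
    ring
  rw [h4]
  exact div_pos (by linarith) h2

lemma gMap_ne_I {w : ℂ} (hw : 1 < ‖w‖) : gMap w ≠ Complex.I := by
  intro h
  rw [gMap, div_eq_iff (add_one_ne_zero_of_one_lt_norm hw)] at h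
  have h' := mul_left_cancel₀ Complex.I_ne_zero h
  have h2 : (2 : ℂ) = 0 := by linear_combination -h'
  norm_num at h2

lemma one_lt_norm_gInv {u : ℂ} (hu : 0 < u.im) (hI : u ≠ Complex.I) : 1 < ‖gInv u‖ := by
  have h1 : 0 < ‖Complex.I - u‖ := norm_pos_iff.mpr (sub_ne_zero.mpr hI.symm)
  rw [gInv, norm_div, one_lt_div h1, ← sq_lt_sq₀ h1.le (norm_nonneg _),
    ← Complex.normSq_eq_norm_sq, ← Complex.normSq_eq_norm_sq, Complex.normSq_apply,
    Complex.normSq_apply]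
  simp
  nlinarith

lemma cpow_half_re_pos {w : ℂ} (hw : w ∈ Complex.slitPlane) : 0 < (w ^ ((1 : ℂ) / 2)).re := by
  rw [one_div, Complex.cpow_inv_two_re]
  apply Real.sqrt_pos.mpr
  rcases Complex.mem_slitPlane_iff.mp hw with h | h
  · have := norm_nonneg w
    linarith
  · have := Complex.abs_re_lt_norm.mpr h
    have := neg_abs_le w.re
    linarith

lemma phiSlit_radicand_mem_slitPlane {δ : ℝ} (hδ : 0 < δ) (hδ1 : δ < 1) {u : ℂ}
    (hu : 0 < u.im) : 1 - (δ : ℂ) ^ 2 - (δ : ℂ) ^ 2 / u ^ 2 ∈ Complex.slitPlane := by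
  have hu0 : u ≠ 0 := by
    rintro rfl
    simp at hu
  set w := 1 - (δ : ℂ) ^ 2 - (δ : ℂ) ^ 2 / u ^ 2 with hw
  rw [Complex.mem_slitPlane_iff]
  by_contra! hcon
  obtain ⟨hre, him⟩ := hcon
  have hwr : w = (w.re : ℂ) := Complex.ext rfl (by simpa using him)
  have key : u ^ 2 * ((1 - δ ^ 2 - w.re : ℝ) : ℂ) = ((δ ^ 2 : ℝ) : ℂ) := by
    push_cast
    rw [← hwr, hw]
    field_simp
    ring
  have hr : 0 < 1 - δ ^ 2 - w.re := by nlinarith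
  have hkim := congrArg Complex.im key
  have hkre := congrArg Complex.re key
  rw [Complex.im_mul_ofReal, Complex.ofReal_im] at hkim
  rw [Complex.re_mul_ofReal, Complex.ofReal_re] at hkre
  have h1 : (u ^ 2).im = 0 := (mul_eq_zero.mp hkim).resolve_right hr.ne'
  have h2 : 0 < (u ^ 2).re := by
    by_contra! h
    nlinarith [mul_nonpos_of_nonpos_of_nonneg h hr.le, pow_pos hδ 2]
  simp only [pow_two, Complex.mul_im, Complex.mul_re] at h1 h2
  have h3 : u.re = 0 := by
    have : u.re * u.im = 0 := by linarith
    exact (mul_eq_zero.mp this).resolve_right hu.ne'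
  rw [h3] at h2
  nlinarith

lemma phiSlit_sq (δ : ℝ) {u : ℂ} (hu : u ≠ 0) :
    phiSlit δ u ^ 2 = u ^ 2 * ((1 - δ ^ 2 : ℝ) : ℂ) - ((δ ^ 2 : ℝ) : ℂ) := by
  have h := Complex.cpow_nat_inv_pow (1 - (δ : ℂ) ^ 2 - (δ : ℂ) ^ 2 / u ^ 2) two_ne_zero
  rw [phiSlit, mul_pow, one_div]
  norm_num at h ⊢
  rw [h]
  field_simp

lemma phiSlit_im_pos {δ : ℝ} (hδ : 0 < δ) (hδ1 : δ < 1) {u : ℂ} (hu : 0 < u.im) :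
    0 < (phiSlit δ u).im := by
  have hu0 : u ≠ 0 := by
    rintro rfl
    simp at hu
  have hs := cpow_half_re_pos (phiSlit_radicand_mem_slitPlane hδ hδ1 hu)
  have hsq := congrArg Complex.im (phiSlit_sq δ hu0)
  have hdiv : (1 - (δ : ℂ) ^ 2 - (δ : ℂ) ^ 2 / u ^ 2) ^ ((1 : ℂ) / 2) = phiSlit δ u / u := by
    rw [phiSlit, mul_div_cancel_left₀ _ hu0]
  have hn : 0 < Complex.normSq u := Complex.normSq_pos.mpr hu0
  rw [hdiv, Complex.div_re, ← add_div] at hs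
  have hs' := (div_pos_iff_of_pos_right hn).mp hs
  rw [Complex.sub_im, Complex.im_mul_ofReal, Complex.ofReal_im, pow_two, pow_two,
    Complex.mul_im, Complex.mul_im] at hsq
  set p := phiSlit δ u
  have ha : 0 < 1 - δ ^ 2 := by nlinarith
  by_contra! hp
  have h1 : p.im * u.im ≤ 0 := mul_nonpos_of_nonpos_of_nonneg hp hu.le
  have h2 : 0 < p.re * u.re := by linarith
  have h3 : (p.re * u.re) * (p.im * u.im) = (1 - δ ^ 2) * (u.re * u.im) ^ 2 := by
    linear_combination (u.re * u.im / 2) * hsq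
  have hur : u.re ≠ 0 := right_ne_zero_of_mul h2.ne'
  have h4 : 0 < (1 - δ ^ 2) * (u.re * u.im) ^ 2 := by positivity
  have h5 := mul_nonpos_of_nonneg_of_nonpos h2.le h1
  linarith

lemma phiSlit_ne_I {δ : ℝ} (hδ : 0 < δ) (hδ1 : δ < 1) {u : ℂ} (hu : 0 < u.im)
    (hI : u ≠ Complex.I) : phiSlit δ u ≠ Complex.I := by
  intro h
  have hu0 : u ≠ 0 := by
    rintro rfl
    simp at hu
  have hsq := phiSlit_sq δ hu0
  have ha : ((1 - δ ^ 2 : ℝ) : ℂ) ≠ 0 := by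
    have : 0 < 1 - δ ^ 2 := by nlinarith
    exact_mod_cast this.ne'
  rw [h, Complex.I_sq] at hsq
  have hmul : (u - Complex.I) * (u + Complex.I) = 0 := by
    apply (mul_eq_zero.mp _).resolve_right ha
    push_cast at hsq ⊢
    linear_combination -hsq - (1 - (δ : ℂ) ^ 2) * Complex.I_sq
  rcases mul_eq_zero.mp hmul with h | h
  · exact hI (sub_eq_zero.mp h)
  · rw [eq_neg_of_add_eq_zero_left h] at hu
    norm_num at hu

lemma one_lt_norm_gInv_phiSlit_gMap {δ : ℝ} (hδ : 0 < δ) (hδ1 : δ < 1) {w : ℂ}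
    (hw : 1 < ‖w‖) : 1 < ‖gInv (phiSlit δ (gMap w))‖ :=
  one_lt_norm_gInv (phiSlit_im_pos hδ hδ1 (gMap_im_pos hw))
    (phiSlit_ne_I hδ hδ1 (gMap_im_pos hw) (gMap_ne_I hw))

lemma fN_slitAt {N δ : ℝ} (hN : 0 < N) (hδ : 0 < δ) (hδ1 : δ < 1) (x : ℝ) {z : ℂ}
    (hz : 1 < ‖fN N z‖) :
    fN N (slitAt N δ x z) = rotN N (-x) (gInv (phiSlit δ (gMap (rotN N x (fN N z))))) := by
  apply fN_fNinv hN
  rw [← norm_pos_iff, norm_rotN]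
  rw [← norm_rotN N x] at hz
  exact one_pos.trans (one_lt_norm_gInv_phiSlit_gMap hδ hδ1 hz)

lemma one_lt_norm_fN_slitAt {N δ : ℝ} (hN : 0 < N) (hδ : 0 < δ) (hδ1 : δ < 1) (x : ℝ) {z : ℂ}
    (hz : 1 < ‖fN N z‖) : 1 < ‖fN N (slitAt N δ x z)‖ := by
  rw [fN_slitAt hN hδ hδ1 x hz, norm_rotN]
  rw [← norm_rotN N x] at hz
  exact one_lt_norm_gInv_phiSlit_gMap hδ hδ1 hz

lemma one_lt_norm_fN_foldr_slitAt {N δ : ℝ} (hN : 0 < N) (hδ : 0 < δ) (hδ1 : δ < 1)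
    (l : List ℝ) {z : ℂ} (hz : 1 < ‖fN N z‖) :
    1 < ‖fN N (l.foldr (fun x w => slitAt N δ x w) z)‖ := by
  induction l with
  | nil => exact hz
  | cons x l ih => exact one_lt_norm_fN_slitAt hN hδ hδ1 x ih

lemma fN_etaShift {N : ℝ} (hN : 0 < N) (y : ℝ) {z : ℂ} (hz : 1 < ‖fN N z‖) :
    fN N (etaShift N y z) = rotN N y (fN N z) := by
  apply fN_fNinv hN
  rw [← norm_pos_iff, norm_rotN]
  exact one_pos.trans hz

lemma fN_foldr_slitAt_etaShift {N δ : ℝ} (hN : 0 < N) (hδ : 0 < δ) (hδ1 : δ < 1)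
    (l : List ℝ) (y : ℝ) {z : ℂ} (hz : 1 < ‖fN N z‖) :
    fN N (l.foldr (fun x w => slitAt N δ x w) (etaShift N y z))
      = rotN N y (fN N ((l.map (fun x => x + y)).foldr (fun x w => slitAt N δ x w) z)) := by
  have hη : 1 < ‖fN N (etaShift N y z)‖ := by rwa [fN_etaShift hN y hz, norm_rotN]
  induction l with
  | nil => exact fN_etaShift hN y hz
  | cons x l ih =>
    simp only [List.foldr_cons, List.map_cons]
    rw [fN_slitAt hN hδ hδ1 x (one_lt_norm_fN_foldr_slitAt hN hδ hδ1 l hη),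
      fN_slitAt hN hδ hδ1 (x + y) (one_lt_norm_fN_foldr_slitAt hN hδ hδ1 _ hz), ih,
      rotN_rotN, rotN_rotN]
    congr 1
    ring

/-- Conjugating a composition of slit maps by the cylinder shift `η_y` shifts all
attachment points by `y`, as self-maps of the cylinder (i.e. after applying `f_N`). -/
theorem slit_composition_shift (N δ : ℝ) (hN : 0 < N) (hδ : 0 < δ) (hδ1 : δ < 1)
    (l : List ℝ) (hl : l ≠ []) (y : ℝ) (z : ℂ) (hz : 0 < z.im) :
    fN N (etaShift N (-y) (l.foldr (fun x w => slitAt N δ x w) (etaShift N y z)))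
      = fN N ((l.map (fun x => x + y)).foldr (fun x w => slitAt N δ x w) z) := by
  have hw := one_lt_norm_fN hN hz
  have hη : 1 < ‖fN N (etaShift N y z)‖ := by rwa [fN_etaShift hN y hw, norm_rotN]
  rw [fN_etaShift hN (-y) (one_lt_norm_fN_foldr_slitAt hN hδ hδ1 l hη),
    fN_foldr_slitAt_etaShift hN hδ hδ1 l y hw, rotN_rotN, neg_add_cancel, rotN_zero]
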